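/- For all m, n ≥ 3, the mixed metric dimension of the torus graph T_{m,n} = C_m □ C_n equals 4. -/

import Mathlib

open SimpleGraph

/-- Distance from a vertex `w` to an edge `e` (as a `Sym2`). -/
noncomputable def edist {V : Type*} (G : SimpleGraph V) (w : V) (e : Sym2 V) : Nat :=
  Sym2.lift ⟨fun u v => min (G.dist w u) (G.dist w v), fun u v => min_comm _ _⟩ e

/-- `S` is a mixed resolving set: every two distinct elements of `V ∪ E`
are distinguished by the distance to some vertex of `S`. -/
def MixedResolvingSet {V : Type*} (G : SimpleGraph V) (S : Set V) : Prop :=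
  (∀ u v : V, u ≠ v → ∃ w ∈ S, G.dist w u ≠ G.dist w v) ∧
  (∀ e ∈ G.edgeSet, ∀ f ∈ G.edgeSet, e ≠ f → ∃ w ∈ S, edist G w e ≠ edist G w f) ∧
  (∀ u : V, ∀ e ∈ G.edgeSet, ∃ w ∈ S, G.dist w u ≠ edist G w e)

/-- The mixed metric dimension of `G`. -/
noncomputable def mixedDim {V : Type*} (G : SimpleGraph V) : Nat :=
  sInf {n | ∃ S : Set V, MixedResolvingSet G S ∧ S.ncard = n}

/-- The cycle graph on `ZMod n`. -/
def cycleZ (n : Nat) : SimpleGraph (ZMod n) :=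
  SimpleGraph.fromRel (fun u v => u - v = 1)

/-- The torus graph `T_{m,n} = C_m □ C_n`. -/
def torus (m n : Nat) : SimpleGraph (ZMod m × ZMod n) :=
  (cycleZ m).boxProd (cycleZ n)

/-! ### Lower bound -/

/-- A graph with a mixed resolving set `S` containing a vertex with four neighbours has `|S| ≥ 4`. -/
theorem lower_aux {V : Type*} [Finite V] (G : SimpleGraph V) (S : Set V)
    (hS : MixedResolvingSet G S) (v : V) (hv : v ∈ S) (u : Fin 4 → V)
    (hu : Function.Injective u) (hadj : ∀ i, G.Adj v (u i)) : 4 ≤ S.ncard := by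
  classical
  have hfin : S.Finite := Set.toFinite S
  obtain ⟨-, h2, h3⟩ := hS
  have hE : ∀ w i, _root_.edist G w s(v, u i) = min (G.dist w v) (G.dist w (u i)) :=
    fun w i => rfl
  have hv0 : ∀ i, _root_.edist G v s(v, u i) = 0 := by
    intro i; rw [hE]; simp
  let T : Finset V := hfin.toFinset.erase v
  let φ : Fin 4 → Finset V := fun i => T.filter (fun w => G.dist w v ≠ _root_.edist G w s(v, u i))
  have hmem : ∀ i w, w ∈ φ i ↔ (w ≠ v ∧ w ∈ S) ∧ G.dist w v ≠ _root_.edist G w s(v, u i) := by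
    intro i w
    simp [φ, T]
  have hne : ∀ i, φ i ≠ ∅ := by
    intro i h
    obtain ⟨w, hw, hd⟩ := h3 v s(v, u i) (hadj i)
    have hwv : w ≠ v := by
      rintro rfl
      apply hd
      rw [hv0]; simp
    have : w ∈ φ i := (hmem i w).2 ⟨⟨hwv, hw⟩, hd⟩
    rw [h] at this
    simp at this
  have hinj : Function.Injective φ := by
    intro i j hij
    by_contra hne'
    have he : s(v, u i) ≠ s(v, u j) := by
      intro h
      rw [Sym2.congr_right] at h
      exact hne' (hu h)
    obtain ⟨w, hw, hd⟩ := h2 _ (hadj i) _ (hadj j) he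
    have hwv : w ≠ v := by
      rintro rfl
      apply hd
      rw [hv0, hv0]
    have hi := hmem i w
    have hj := hmem j w
    rw [hij] at hi
    have hiff : G.dist w v ≠ _root_.edist G w s(v, u i) ↔
        G.dist w v ≠ _root_.edist G w s(v, u j) := by
      constructor
      · intro h
        exact (hj.1 (hi.2 ⟨⟨hwv, hw⟩, h⟩)).2
      · intro h
        exact (hi.1 (hj.2 ⟨⟨hwv, hw⟩, h⟩)).2
    have a := (hadj i).diff_dist_adj (u := w)
    have b := (hadj j).diff_dist_adj (u := w)
    rw [hE, hE] at hiff hd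
    omega
  have hcard : (Finset.univ.image φ).card = 4 := by
    rw [Finset.card_image_of_injective _ hinj]; simp
  have hsub : Finset.univ.image φ ⊆ T.powerset.erase ∅ := by
    intro A hA
    simp only [Finset.mem_image, Finset.mem_univ, true_and] at hA
    obtain ⟨i, rfl⟩ := hA
    rw [Finset.mem_erase, Finset.mem_powerset]
    exact ⟨hne i, Finset.filter_subset _ _⟩
  have hle := Finset.card_le_card hsub
  rw [hcard, Finset.card_erase_of_mem (by simp), Finset.card_powerset] at hle
  have hT : T.card = S.ncard - 1 := by
    rw [Finset.card_erase_of_mem (by simpa using hv), Set.ncard_eq_toFinset_card S hfin]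
  rw [hT] at hle
  by_contra hlt
  have : S.ncard - 1 ≤ 2 := by omega
  have := Nat.pow_le_pow_right (n := 2) (by norm_num) this
  omega

/-! ### Arithmetic of `ZMod m` -/

theorem val_add_one' (m : ℕ) (hm : 3 ≤ m) (x : ZMod m) :
    (x.val + 1 < m ∧ (x + 1).val = x.val + 1) ∨ (x.val + 1 = m ∧ (x + 1).val = 0) := by
  have : NeZero m := ⟨by omega⟩
  have h1 : (1 : ZMod m).val = 1 := ZMod.val_one'' (by omega)
  have hx := ZMod.val_lt x
  rcases Nat.lt_or_ge (x.val + 1) m with h | h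
  · left
    refine ⟨h, ?_⟩
    rw [ZMod.val_add_of_lt (by omega), h1]
  · right
    refine ⟨by omega, ?_⟩
    rw [ZMod.val_add, h1, show x.val + 1 = m by omega, Nat.mod_self]

theorem cyc_adj (m : ℕ) (hm : 3 ≤ m) (x y : ZMod m) :
    (cycleZ m).Adj x y ↔ (y = x + 1 ∨ x = y + 1) := by
  have : Fact (1 < m) := ⟨by omega⟩
  unfold cycleZ
  rw [SimpleGraph.fromRel_adj]
  constructor
  · rintro ⟨-, h | h⟩
    · right; rw [← h]; ring
    · left; rw [← h]; ring
  · rintro (h | h)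
    · subst h; simp
    · subst h; simp

/-! ### Distances -/

/-- Characterisation of distance from `w`. -/
theorem dist_char {V : Type*} (G : SimpleGraph V) (w : V) (f : V → ℕ) (h0 : ∀ v, f v = 0 ↔ v = w)
    (h1 : ∀ a b, G.Adj a b → f b ≤ f a + 1)
    (h2 : ∀ a, f a ≠ 0 → ∃ b, G.Adj b a ∧ f b + 1 = f a) (v : V) :
    G.Reachable w v ∧ G.dist w v = f v := by
  have key : ∀ n v, f v = n → ∃ p : G.Walk w v, p.length = n := by
    intro n
    induction n with
    | zero =>
      intro v hv
      have := (h0 v).1 hv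
      subst this
      exact ⟨Walk.nil, rfl⟩
    | succ n ih =>
      intro v hv
      obtain ⟨b, hb, hfb⟩ := h2 v (by omega)
      obtain ⟨p, hp⟩ := ih b (by omega)
      exact ⟨p.concat hb, by rw [Walk.length_concat, hp]⟩
  have low : ∀ a b (p : G.Walk a b), f b ≤ f a + p.length := by
    intro a b p
    induction p with
    | nil => simp
    | cons h p ih =>
      have := h1 _ _ h
      rw [Walk.length_cons]
      omega
  obtain ⟨p, hp⟩ := key _ v rfl
  refine ⟨p.reachable, le_antisymm (hp ▸ dist_le p) ?_⟩
  obtain ⟨q, hq⟩ := p.reachable.exists_walk_length_eq_dist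
  have := low _ _ q
  have := (h0 w).2 rfl
  omega

set_option maxHeartbeats 2000000 in
theorem cyc_dist (m : ℕ) (hm : 3 ≤ m) (a b : ZMod m) :
    (cycleZ m).Reachable a b ∧ (cycleZ m).dist a b =
      min ((a.val - b.val) + (b.val - a.val)) (m - ((a.val - b.val) + (b.val - a.val))) := by
  have : NeZero m := ⟨by omega⟩
  have ha := ZMod.val_lt a
  refine dist_char (cycleZ m) a
    (fun b => min ((a.val - b.val) + (b.val - a.val)) (m - ((a.val - b.val) + (b.val - a.val))))
    ?_ ?_ ?_ b
  · intro v
    have hv := ZMod.val_lt v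
    rw [← (ZMod.val_injective m).eq_iff]
    omega
  · intro x y h
    have hx := ZMod.val_lt x
    have hy := ZMod.val_lt y
    rcases (cyc_adj m hm x y).1 h with h | h
    · have := val_add_one' m hm x
      rw [← h] at this
      omega
    · have := val_add_one' m hm y
      rw [← h] at this
      omega
  · intro x hx0
    have hx := ZMod.val_lt x
    have e1 := val_add_one' m hm x
    have e2 := val_add_one' m hm (x - 1)
    have hx1 := ZMod.val_lt (x - 1)
    rw [sub_add_cancel] at e2
    have A1 : (cycleZ m).Adj (x + 1) x := (cyc_adj m hm _ _).2 (Or.inr rfl)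
    have A2 : (cycleZ m).Adj (x - 1) x := (cyc_adj m hm _ _).2 (Or.inl (by ring))
    generalize hX : x.val = X at *
    generalize hA : a.val = A at *
    generalize hP : (x + 1).val = P at *
    generalize hQ : (x - 1).val = Q at *
    rcases Nat.lt_trichotomy A X with h | h | h
    · rcases Nat.lt_or_ge (m - (X - A)) (X - A) with h' | h'
      · refine ⟨x + 1, A1, ?_⟩
        rw [hP]
        rcases e1 with e1 | e1 <;> omega
      · refine ⟨x - 1, A2, ?_⟩
        rw [hQ]
        rcases e2 with e2 | e2 <;> omega
    · omega
    · rcases Nat.lt_or_ge (m - (A - X)) (A - X) with h' | h'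
      · refine ⟨x - 1, A2, ?_⟩
        rw [hQ]
        rcases e2 with e2 | e2 <;> omega
      · refine ⟨x + 1, A1, ?_⟩
        rw [hP]
        rcases e1 with e1 | e1 <;> omega

theorem torus_dist (m n : ℕ) (hm : 3 ≤ m) (hn : 3 ≤ n) (a b : ZMod m × ZMod n) :
    (torus m n).dist a b = (cycleZ m).dist a.1 b.1 + (cycleZ n).dist a.2 b.2 := by
  have h := SimpleGraph.edist_boxProd (G := cycleZ m) (H := cycleZ n) a b
  have r1 := (cyc_dist m hm a.1 b.1).1
  have r2 := (cyc_dist n hn a.2 b.2).1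
  have r : (torus m n).Reachable a b := by
    unfold torus
    rw [reachable_boxProd]
    exact ⟨r1, r2⟩
  rw [← r1.coe_dist_eq_edist, ← r2.coe_dist_eq_edist] at h
  have h' : ((torus m n).dist a b : ℕ∞) = _ := r.coe_dist_eq_edist.trans h
  exact_mod_cast h'

/-! ### The numeric core -/

/-- distance in the cycle from `0` to vertex `x` (`t = 0`) or edge `{x, x+1}` (`t = 1`) -/
def d0 (m x t : ℕ) : ℕ := min x (m - t - x)
/-- distance from `-1` -/
def d1 (m x t : ℕ) : ℕ := min (x + 1) (m - 1 - t - x)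
/-- distance from `m / 2` -/
def dk (m x t : ℕ) : ℕ := (x - m / 2) + (m / 2 - t - x)

theorem form_even_zero (k x : ℕ) (hx : x < 2 * k) :
    (x < k ∧ d0 (2 * k) x 0 = x ∧ d1 (2 * k) x 0 = x + 1 ∧ dk (2 * k) x 0 + x = k) ∨
    (k ≤ x ∧ d0 (2 * k) x 0 + x = 2 * k ∧ d1 (2 * k) x 0 + x + 1 = 2 * k ∧
      dk (2 * k) x 0 + k = x) := by
  unfold d0 d1 dk
  rw [show 2 * k / 2 = k by omega]
  omega

theorem form_even_one (k x : ℕ) (hx : x < 2 * k) (hk : 2 ≤ k) :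
    (x + 1 < k ∧ d0 (2 * k) x 1 = x ∧ d1 (2 * k) x 1 = x + 1 ∧ dk (2 * k) x 1 + x + 1 = k) ∨
    (x + 1 = k ∧ d0 (2 * k) x 1 = x ∧ d1 (2 * k) x 1 = x ∧ dk (2 * k) x 1 = 0) ∨
    (k ≤ x ∧ x + 1 < 2 * k ∧ d0 (2 * k) x 1 + x + 1 = 2 * k ∧ d1 (2 * k) x 1 + x + 2 = 2 * k ∧
      dk (2 * k) x 1 + k = x) ∨
    (x + 1 = 2 * k ∧ d0 (2 * k) x 1 = 0 ∧ d1 (2 * k) x 1 = 0 ∧ dk (2 * k) x 1 + k = x) := by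
  unfold d0 d1 dk
  rw [show 2 * k / 2 = k by omega]
  omega

theorem form_odd_zero (k x : ℕ) (hx : x < 2 * k + 1) :
    (x < k ∧ d0 (2 * k + 1) x 0 = x ∧ d1 (2 * k + 1) x 0 = x + 1 ∧ dk (2 * k + 1) x 0 + x = k) ∨
    (x = k ∧ d0 (2 * k + 1) x 0 = x ∧ d1 (2 * k + 1) x 0 = k ∧ dk (2 * k + 1) x 0 = 0) ∨
    (k < x ∧ d0 (2 * k + 1) x 0 + x = 2 * k + 1 ∧ d1 (2 * k + 1) x 0 + x = 2 * k ∧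
      dk (2 * k + 1) x 0 + k = x) := by
  unfold d0 d1 dk
  rw [show (2 * k + 1) / 2 = k by omega]
  omega

theorem form_odd_one (k x : ℕ) (hx : x < 2 * k + 1) (hk : 1 ≤ k) :
    (x < k ∧ d0 (2 * k + 1) x 1 = x ∧ d1 (2 * k + 1) x 1 = x + 1 ∧
      dk (2 * k + 1) x 1 + x + 1 = k) ∨
    (k ≤ x ∧ x < 2 * k ∧ d0 (2 * k + 1) x 1 + x = 2 * k ∧ d1 (2 * k + 1) x 1 + x + 1 = 2 * k ∧
      dk (2 * k + 1) x 1 + k = x) ∨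
    (x = 2 * k ∧ d0 (2 * k + 1) x 1 = 0 ∧ d1 (2 * k + 1) x 1 = 0 ∧ dk (2 * k + 1) x 1 = k) := by
  unfold d0 d1 dk
  rw [show (2 * k + 1) / 2 = k by omega]
  omega

theorem pair_even_zero_zero (k x x' : ℕ) (hk : 2 ≤ k) (hx : x < 2 * k) (hx' : x' < 2 * k)
    (r q : ℤ) (e0 : (d0 (2 * k) x' 0 : ℤ) - d0 (2 * k) x 0 = r)
    (e1 : (d1 (2 * k) x' 0 : ℤ) - d1 (2 * k) x 0 = -q) (e2 : (dk (2 * k) x' 0 : ℤ) - dk (2 * k) x 0 = r) :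
    (x = x' ∧ r = 0 ∧ q = 0) ∨ (r = 0 ∧ q ≠ 0) := by
  have f := form_even_zero k x hx
  have f' := form_even_zero k x' hx'
  generalize d0 (2 * k) x 0 = a0 at *
  generalize d1 (2 * k) x 0 = a1 at *
  generalize dk (2 * k) x 0 = a2 at *
  generalize d0 (2 * k) x' 0 = b0 at *
  generalize d1 (2 * k) x' 0 = b1 at *
  generalize dk (2 * k) x' 0 = b2 at *
  rcases f with f | f <;> rcases f' with f' | f' <;> omega

theorem pair_even_zero_one (k x x' : ℕ) (hk : 2 ≤ k) (hx : x < 2 * k) (hx' : x' < 2 * k)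
    (r q : ℤ) (e0 : (d0 (2 * k) x' 1 : ℤ) - d0 (2 * k) x 0 = r)
    (e1 : (d1 (2 * k) x' 1 : ℤ) - d1 (2 * k) x 0 = -q) (e2 : (dk (2 * k) x' 1 : ℤ) - dk (2 * k) x 0 = r) :
    (r = -1 ∧ q = -1) ∨ (r = 0 ∧ q = 1) ∨ (r = 0 ∧ q = 2) := by
  have f := form_even_zero k x hx
  have f' := form_even_one k x' hx' hk
  generalize d0 (2 * k) x 0 = a0 at *
  generalize d1 (2 * k) x 0 = a1 at *
  generalize dk (2 * k) x 0 = a2 at *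
  generalize d0 (2 * k) x' 1 = b0 at *
  generalize d1 (2 * k) x' 1 = b1 at *
  generalize dk (2 * k) x' 1 = b2 at *
  rcases f with f | f <;> rcases f' with f' | f' | f' | f' <;> omega

theorem pair_even_one_zero (k x x' : ℕ) (hk : 2 ≤ k) (hx : x < 2 * k) (hx' : x' < 2 * k)
    (r q : ℤ) (e0 : (d0 (2 * k) x' 0 : ℤ) - d0 (2 * k) x 1 = r)
    (e1 : (d1 (2 * k) x' 0 : ℤ) - d1 (2 * k) x 1 = -q) (e2 : (dk (2 * k) x' 0 : ℤ) - dk (2 * k) x 1 = r) :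
    (r = 1 ∧ q = 1) ∨ (r = 0 ∧ q = -1) ∨ (r = 0 ∧ q = -2) := by
  have f := form_even_one k x hx hk
  have f' := form_even_zero k x' hx'
  generalize d0 (2 * k) x 1 = a0 at *
  generalize d1 (2 * k) x 1 = a1 at *
  generalize dk (2 * k) x 1 = a2 at *
  generalize d0 (2 * k) x' 0 = b0 at *
  generalize d1 (2 * k) x' 0 = b1 at *
  generalize dk (2 * k) x' 0 = b2 at *
  rcases f with f | f | f | f <;> rcases f' with f' | f' <;> omega

theorem pair_even_one_one (k x x' : ℕ) (hk : 2 ≤ k) (hx : x < 2 * k) (hx' : x' < 2 * k)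
    (r q : ℤ) (e0 : (d0 (2 * k) x' 1 : ℤ) - d0 (2 * k) x 1 = r)
    (e1 : (d1 (2 * k) x' 1 : ℤ) - d1 (2 * k) x 1 = -q) (e2 : (dk (2 * k) x' 1 : ℤ) - dk (2 * k) x 1 = r) :
    (x = x' ∧ r = 0 ∧ q = 0) ∨ (r = 0 ∧ q ≠ 0) := by
  have f := form_even_one k x hx hk
  have f' := form_even_one k x' hx' hk
  generalize d0 (2 * k) x 1 = a0 at *
  generalize d1 (2 * k) x 1 = a1 at *
  generalize dk (2 * k) x 1 = a2 at *
  generalize d0 (2 * k) x' 1 = b0 at *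
  generalize d1 (2 * k) x' 1 = b1 at *
  generalize dk (2 * k) x' 1 = b2 at *
  rcases f with f | f | f | f <;> rcases f' with f' | f' | f' | f' <;> omega

theorem pair_odd_zero_zero (k x x' : ℕ) (hk : 1 ≤ k) (hx : x < 2 * k + 1) (hx' : x' < 2 * k + 1)
    (r q : ℤ) (e0 : (d0 (2 * k + 1) x' 0 : ℤ) - d0 (2 * k + 1) x 0 = r)
    (e1 : (d1 (2 * k + 1) x' 0 : ℤ) - d1 (2 * k + 1) x 0 = -q) (e2 : (dk (2 * k + 1) x' 0 : ℤ) - dk (2 * k + 1) x 0 = r) :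
    (x = x' ∧ r = 0 ∧ q = 0) ∨ (r = 0 ∧ q ≠ 0) := by
  have f := form_odd_zero k x hx
  have f' := form_odd_zero k x' hx'
  generalize d0 (2 * k + 1) x 0 = a0 at *
  generalize d1 (2 * k + 1) x 0 = a1 at *
  generalize dk (2 * k + 1) x 0 = a2 at *
  generalize d0 (2 * k + 1) x' 0 = b0 at *
  generalize d1 (2 * k + 1) x' 0 = b1 at *
  generalize dk (2 * k + 1) x' 0 = b2 at *
  rcases f with f | f | f <;> rcases f' with f' | f' | f' <;> omega

theorem pair_odd_zero_one (k x x' : ℕ) (hk : 1 ≤ k) (hx : x < 2 * k + 1) (hx' : x' < 2 * k + 1)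
    (r q : ℤ) (e0 : (d0 (2 * k + 1) x' 1 : ℤ) - d0 (2 * k + 1) x 0 = r)
    (e1 : (d1 (2 * k + 1) x' 1 : ℤ) - d1 (2 * k + 1) x 0 = -q) (e2 : (dk (2 * k + 1) x' 1 : ℤ) - dk (2 * k + 1) x 0 = r) :
    (r = -1 ∧ q = -1) ∨ (r = 0 ∧ q = 1) ∨ (r = 0 ∧ q = 2) := by
  have f := form_odd_zero k x hx
  have f' := form_odd_one k x' hx' hk
  generalize d0 (2 * k + 1) x 0 = a0 at *
  generalize d1 (2 * k + 1) x 0 = a1 at *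
  generalize dk (2 * k + 1) x 0 = a2 at *
  generalize d0 (2 * k + 1) x' 1 = b0 at *
  generalize d1 (2 * k + 1) x' 1 = b1 at *
  generalize dk (2 * k + 1) x' 1 = b2 at *
  rcases f with f | f | f <;> rcases f' with f' | f' | f' <;> omega

theorem pair_odd_one_zero (k x x' : ℕ) (hk : 1 ≤ k) (hx : x < 2 * k + 1) (hx' : x' < 2 * k + 1)
    (r q : ℤ) (e0 : (d0 (2 * k + 1) x' 0 : ℤ) - d0 (2 * k + 1) x 1 = r)
    (e1 : (d1 (2 * k + 1) x' 0 : ℤ) - d1 (2 * k + 1) x 1 = -q) (e2 : (dk (2 * k + 1) x' 0 : ℤ) - dk (2 * k + 1) x 1 = r) :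
    (r = 1 ∧ q = 1) ∨ (r = 0 ∧ q = -1) ∨ (r = 0 ∧ q = -2) := by
  have f := form_odd_one k x hx hk
  have f' := form_odd_zero k x' hx'
  generalize d0 (2 * k + 1) x 1 = a0 at *
  generalize d1 (2 * k + 1) x 1 = a1 at *
  generalize dk (2 * k + 1) x 1 = a2 at *
  generalize d0 (2 * k + 1) x' 0 = b0 at *
  generalize d1 (2 * k + 1) x' 0 = b1 at *
  generalize dk (2 * k + 1) x' 0 = b2 at *
  rcases f with f | f | f <;> rcases f' with f' | f' | f' <;> omega

theorem pair_odd_one_one (k x x' : ℕ) (hk : 1 ≤ k) (hx : x < 2 * k + 1) (hx' : x' < 2 * k + 1)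
    (r q : ℤ) (e0 : (d0 (2 * k + 1) x' 1 : ℤ) - d0 (2 * k + 1) x 1 = r)
    (e1 : (d1 (2 * k + 1) x' 1 : ℤ) - d1 (2 * k + 1) x 1 = -q) (e2 : (dk (2 * k + 1) x' 1 : ℤ) - dk (2 * k + 1) x 1 = r) :
    (x = x' ∧ r = 0 ∧ q = 0) ∨ (r = 0 ∧ q ≠ 0) := by
  have f := form_odd_one k x hx hk
  have f' := form_odd_one k x' hx' hk
  generalize d0 (2 * k + 1) x 1 = a0 at *
  generalize d1 (2 * k + 1) x 1 = a1 at *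
  generalize dk (2 * k + 1) x 1 = a2 at *
  generalize d0 (2 * k + 1) x' 1 = b0 at *
  generalize d1 (2 * k + 1) x' 1 = b1 at *
  generalize dk (2 * k + 1) x' 1 = b2 at *
  rcases f with f | f | f <;> rcases f' with f' | f' | f' <;> omega

theorem coreY (m x t x' t' : ℕ) (hm : 3 ≤ m) (hx : x < m) (hx' : x' < m) (ht : t ≤ 1) (ht' : t' ≤ 1)
    (r q : ℤ) (e0 : (d0 m x' t' : ℤ) - d0 m x t = r) (e1 : (d1 m x' t' : ℤ) - d1 m x t = -q)
    (e2 : (dk m x' t' : ℤ) - dk m x t = r) :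
    (x = x' ∧ t = t' ∧ r = 0 ∧ q = 0) ∨
    (t = t' ∧ r = 0 ∧ q ≠ 0) ∨
    (t = 0 ∧ t' = 1 ∧ ((r = -1 ∧ q = -1) ∨ (r = 0 ∧ q = 1) ∨ (r = 0 ∧ q = 2))) ∨
    (t = 1 ∧ t' = 0 ∧ ((r = 1 ∧ q = 1) ∨ (r = 0 ∧ q = -1) ∨ (r = 0 ∧ q = -2))) := by
  obtain ⟨k, rfl | rfl⟩ : ∃ k, m = 2 * k ∨ m = 2 * k + 1 := ⟨m / 2, by omega⟩
  all_goals obtain rfl | rfl : t = 0 ∨ t = 1 := by omega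
  all_goals obtain rfl | rfl : t' = 0 ∨ t' = 1 := by omega
  · have h := pair_even_zero_zero k x x' (by omega) hx hx' r q e0 e1 e2
    rcases h with ⟨a, b, c⟩ | ⟨b, c⟩
    · exact Or.inl ⟨a, rfl, b, c⟩
    · exact Or.inr (Or.inl ⟨rfl, b, c⟩)
  · have h := pair_even_zero_one k x x' (by omega) hx hx' r q e0 e1 e2
    exact Or.inr (Or.inr (Or.inl ⟨rfl, rfl, h⟩))
  · have h := pair_even_one_zero k x x' (by omega) hx hx' r q e0 e1 e2
    exact Or.inr (Or.inr (Or.inr ⟨rfl, rfl, h⟩))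
  · have h := pair_even_one_one k x x' (by omega) hx hx' r q e0 e1 e2
    rcases h with ⟨a, b, c⟩ | ⟨b, c⟩
    · exact Or.inl ⟨a, rfl, b, c⟩
    · exact Or.inr (Or.inl ⟨rfl, b, c⟩)
  · have h := pair_odd_zero_zero k x x' (by omega) hx hx' r q e0 e1 e2
    rcases h with ⟨a, b, c⟩ | ⟨b, c⟩
    · exact Or.inl ⟨a, rfl, b, c⟩
    · exact Or.inr (Or.inl ⟨rfl, b, c⟩)
  · have h := pair_odd_zero_one k x x' (by omega) hx hx' r q e0 e1 e2
    exact Or.inr (Or.inr (Or.inl ⟨rfl, rfl, h⟩))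
  · have h := pair_odd_one_zero k x x' (by omega) hx hx' r q e0 e1 e2
    exact Or.inr (Or.inr (Or.inr ⟨rfl, rfl, h⟩))
  · have h := pair_odd_one_one k x x' (by omega) hx hx' r q e0 e1 e2
    rcases h with ⟨a, b, c⟩ | ⟨b, c⟩
    · exact Or.inl ⟨a, rfl, b, c⟩
    · exact Or.inr (Or.inl ⟨rfl, b, c⟩)

theorem core (m n x t y s x' t' y' s' : ℕ) (hm : 3 ≤ m) (hn : 3 ≤ n)
    (hx : x < m) (hx' : x' < m) (hy : y < n) (hy' : y' < n) (hts : t + s ≤ 1) (hts' : t' + s' ≤ 1)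
    (e1 : d1 m x t + d0 n y s = d1 m x' t' + d0 n y' s')
    (e2 : d1 m x t + dk n y s = d1 m x' t' + dk n y' s')
    (e3 : d0 m x t + d1 n y s = d0 m x' t' + d1 n y' s')
    (e4 : dk m x t + d1 n y s = dk m x' t' + d1 n y' s') :
    x = x' ∧ t = t' ∧ y = y' ∧ s = s' := by
  have hX := coreY m x t x' t' hm hx hx' (by omega) (by omega)
    ((d0 m x' t' : ℤ) - d0 m x t) ((d0 n y' s' : ℤ) - d0 n y s) rfl (by omega) (by omega)
  have hY := coreY n y s y' s' hn hy hy' (by omega) (by omega)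
    ((d0 n y' s' : ℤ) - d0 n y s) ((d0 m x' t' : ℤ) - d0 m x t) rfl (by omega) (by omega)
  generalize ((d0 n y' s' : ℤ) - d0 n y s) = r at hX hY
  generalize ((d0 m x' t' : ℤ) - d0 m x t) = q at hX hY
  clear e1 e2 e3 e4 hx hx' hy hy' hm hn
  omega

/-! ### The resolving set -/

theorem cyc_d0 (m : ℕ) (hm : 3 ≤ m) (x : ZMod m) :
    (cycleZ m).dist 0 x = d0 m x.val 0 ∧
    min ((cycleZ m).dist 0 x) ((cycleZ m).dist 0 (x + 1)) = d0 m x.val 1 := by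
  have : NeZero m := ⟨by omega⟩
  have hx := ZMod.val_lt x
  have h := val_add_one' m hm x
  have h0 : (0 : ZMod m).val = 0 := ZMod.val_zero
  rw [(cyc_dist m hm _ _).2, (cyc_dist m hm _ _).2, h0]
  unfold d0
  omega

theorem cyc_d1 (m : ℕ) (hm : 3 ≤ m) (x : ZMod m) :
    (cycleZ m).dist (-1) x = d1 m x.val 0 ∧
    min ((cycleZ m).dist (-1) x) ((cycleZ m).dist (-1) (x + 1)) = d1 m x.val 1 := by
  have : NeZero m := ⟨by omega⟩
  have hx := ZMod.val_lt x
  have h := val_add_one' m hm x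
  have h0 : (-1 : ZMod m).val = m - 1 := by
    have h := val_add_one' m hm (-1)
    rw [neg_add_cancel, ZMod.val_zero] at h
    omega
  rw [(cyc_dist m hm _ _).2, (cyc_dist m hm _ _).2, h0]
  unfold d1
  omega

theorem cyc_dk (m : ℕ) (hm : 3 ≤ m) (x : ZMod m) :
    (cycleZ m).dist ((m / 2 : ℕ) : ZMod m) x = dk m x.val 0 ∧
    min ((cycleZ m).dist ((m / 2 : ℕ) : ZMod m) x)
      ((cycleZ m).dist ((m / 2 : ℕ) : ZMod m) (x + 1)) = dk m x.val 1 := by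
  have : NeZero m := ⟨by omega⟩
  have hx := ZMod.val_lt x
  have h := val_add_one' m hm x
  have h0 : ((m / 2 : ℕ) : ZMod m).val = m / 2 := ZMod.val_natCast_of_lt (by omega)
  rw [(cyc_dist m hm _ _).2, (cyc_dist m hm _ _).2, h0]
  unfold dk
  omega

/-- The four-element resolving set. -/
def resSet (m n : ℕ) : Set (ZMod m × ZMod n) :=
  {(-1, 0), (-1, ((n / 2 : ℕ) : ZMod n)), (0, -1), (((m / 2 : ℕ) : ZMod m), -1)}

/-- The distance function to all four points is given by numeric code `(x,t,y,s)`. -/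
def Code (m n : ℕ) (D : ZMod m × ZMod n → ℕ) (x t y s : ℕ) : Prop :=
  x < m ∧ y < n ∧ t + s ≤ 1 ∧
  D (-1, 0) = d1 m x t + d0 n y s ∧
  D (-1, ((n / 2 : ℕ) : ZMod n)) = d1 m x t + dk n y s ∧
  D (0, -1) = d0 m x t + d1 n y s ∧
  D (((m / 2 : ℕ) : ZMod m), -1) = dk m x t + d1 n y s

theorem code_vertex (m n : ℕ) (hm : 3 ≤ m) (hn : 3 ≤ n) (u : ZMod m × ZMod n) :
    Code m n (fun w => (torus m n).dist w u) u.1.val 0 u.2.val 0 := by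
  have : NeZero m := ⟨by omega⟩
  have : NeZero n := ⟨by omega⟩
  refine ⟨ZMod.val_lt _, ZMod.val_lt _, by omega, ?_, ?_, ?_, ?_⟩ <;>
    simp only [torus_dist m n hm hn, (cyc_d0 m hm _).1, (cyc_d1 m hm _).1, (cyc_dk m hm _).1,
      (cyc_d0 n hn _).1, (cyc_d1 n hn _).1, (cyc_dk n hn _).1]

theorem code_h (m n : ℕ) (hm : 3 ≤ m) (hn : 3 ≤ n) (x : ZMod m) (y : ZMod n) :
    Code m n (fun w => _root_.edist (torus m n) w s((x, y), (x + 1, y))) x.val 1 y.val 0 := by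
  have : NeZero m := ⟨by omega⟩
  have : NeZero n := ⟨by omega⟩
  have hE : ∀ w, _root_.edist (torus m n) w s((x, y), (x + 1, y)) =
    min ((cycleZ m).dist w.1 x) ((cycleZ m).dist w.1 (x + 1)) + (cycleZ n).dist w.2 y := by
    intro w
    change min ((torus m n).dist w (x, y)) ((torus m n).dist w (x + 1, y)) = _
    simp only [torus_dist m n hm hn]
    omega
  refine ⟨ZMod.val_lt _, ZMod.val_lt _, by omega, ?_, ?_, ?_, ?_⟩ <;>
    simp only [hE, (cyc_d0 m hm _).2, (cyc_d1 m hm _).2, (cyc_dk m hm _).2,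
      (cyc_d0 n hn _).1, (cyc_d1 n hn _).1, (cyc_dk n hn _).1]

theorem code_v (m n : ℕ) (hm : 3 ≤ m) (hn : 3 ≤ n) (x : ZMod m) (y : ZMod n) :
    Code m n (fun w => _root_.edist (torus m n) w s((x, y), (x, y + 1))) x.val 0 y.val 1 := by
  have : NeZero m := ⟨by omega⟩
  have : NeZero n := ⟨by omega⟩
  have hE : ∀ w, _root_.edist (torus m n) w s((x, y), (x, y + 1)) =
    (cycleZ m).dist w.1 x + min ((cycleZ n).dist w.2 y) ((cycleZ n).dist w.2 (y + 1)) := by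
    intro w
    change min ((torus m n).dist w (x, y)) ((torus m n).dist w (x, y + 1)) = _
    simp only [torus_dist m n hm hn]
    omega
  refine ⟨ZMod.val_lt _, ZMod.val_lt _, by omega, ?_, ?_, ?_, ?_⟩ <;>
    simp only [hE, (cyc_d0 m hm _).1, (cyc_d1 m hm _).1, (cyc_dk m hm _).1,
      (cyc_d0 n hn _).2, (cyc_d1 n hn _).2, (cyc_dk n hn _).2]

theorem code_inj (m n : ℕ) (hm : 3 ≤ m) (hn : 3 ≤ n) (D D' : ZMod m × ZMod n → ℕ)
    (x t y s x' t' y' s' : ℕ) (h : Code m n D x t y s) (h' : Code m n D' x' t' y' s')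
    (heq : ∀ w ∈ resSet m n, D w = D' w) : x = x' ∧ t = t' ∧ y = y' ∧ s = s' := by
  obtain ⟨a1, a2, a3, a4, a5, a6, a7⟩ := h
  obtain ⟨b1, b2, b3, b4, b5, b6, b7⟩ := h'
  refine core m n x t y s x' t' y' s' hm hn a1 b1 a2 b2 a3 b3 ?_ ?_ ?_ ?_
  · rw [← a4, ← b4]; exact heq _ (by simp [resSet])
  · rw [← a5, ← b5]; exact heq _ (by simp [resSet])
  · rw [← a6, ← b6]; exact heq _ (by simp [resSet])
  · rw [← a7, ← b7]; exact heq _ (by simp [resSet])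

theorem torus_edge (m n : ℕ) (hm : 3 ≤ m) (hn : 3 ≤ n) (e : Sym2 (ZMod m × ZMod n))
    (he : e ∈ (torus m n).edgeSet) :
    ∃ x y, e = s((x, y), (x + 1, y)) ∨ e = s((x, y), (x, y + 1)) := by
  induction e with
  | h a b =>
    obtain ⟨a1, a2⟩ := a
    obtain ⟨b1, b2⟩ := b
    rw [SimpleGraph.mem_edgeSet] at he
    unfold torus at he
    rw [boxProd_adj] at he
    rcases he with ⟨h, h'⟩ | ⟨h, h'⟩
    · dsimp only at h h'
      subst h'
      rcases (cyc_adj m hm _ _).1 h with rfl | rfl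
      · exact ⟨a1, a2, Or.inl rfl⟩
      · exact ⟨b1, a2, Or.inl Sym2.eq_swap⟩
    · dsimp only at h h'
      subst h'
      rcases (cyc_adj n hn _ _).1 h with rfl | rfl
      · exact ⟨a1, a2, Or.inr rfl⟩
      · exact ⟨a1, b2, Or.inr Sym2.eq_swap⟩

theorem resSet_resolving (m n : ℕ) (hm : 3 ≤ m) (hn : 3 ≤ n) :
    MixedResolvingSet (torus m n) (resSet m n) := by
  have : NeZero m := ⟨by omega⟩
  have : NeZero n := ⟨by omega⟩
  refine ⟨?_, ?_, ?_⟩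
  · intro u v huv
    by_contra! hc
    have h := code_inj m n hm hn _ _ _ _ _ _ _ _ _ _
      (code_vertex m n hm hn u) (code_vertex m n hm hn v) hc
    exact huv (Prod.ext (ZMod.val_injective m h.1) (ZMod.val_injective n h.2.2.1))
  · intro e he f hf hef
    by_contra! hc
    obtain ⟨x, y, rfl | rfl⟩ := torus_edge m n hm hn e he <;>
    obtain ⟨x', y', rfl | rfl⟩ := torus_edge m n hm hn f hf
    · have h := code_inj m n hm hn _ _ _ _ _ _ _ _ _ _
        (code_h m n hm hn x y) (code_h m n hm hn x' y') hc
      rw [ZMod.val_injective m h.1, ZMod.val_injective n h.2.2.1] at hef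
      exact hef rfl
    · have h := code_inj m n hm hn _ _ _ _ _ _ _ _ _ _
        (code_h m n hm hn x y) (code_v m n hm hn x' y') hc
      omega
    · have h := code_inj m n hm hn _ _ _ _ _ _ _ _ _ _
        (code_v m n hm hn x y) (code_h m n hm hn x' y') hc
      omega
    · have h := code_inj m n hm hn _ _ _ _ _ _ _ _ _ _
        (code_v m n hm hn x y) (code_v m n hm hn x' y') hc
      rw [ZMod.val_injective m h.1, ZMod.val_injective n h.2.2.1] at hef
      exact hef rfl
  · intro u e he
    by_contra! hc
    obtain ⟨x, y, rfl | rfl⟩ := torus_edge m n hm hn e he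
    · have h := code_inj m n hm hn _ _ _ _ _ _ _ _ _ _
        (code_vertex m n hm hn u) (code_h m n hm hn x y) hc
      omega
    · have h := code_inj m n hm hn _ _ _ _ _ _ _ _ _ _
        (code_vertex m n hm hn u) (code_v m n hm hn x y) hc
      omega

theorem torus_lower (m n : ℕ) (hm : 3 ≤ m) (hn : 3 ≤ n) (S : Set (ZMod m × ZMod n))
    (hS : MixedResolvingSet (torus m n) S) : 4 ≤ S.ncard := by
  have : NeZero m := ⟨by omega⟩
  have : NeZero n := ⟨by omega⟩
  have hA : ∀ k : ℕ, 3 ≤ k → ∀ x : ZMod k, x + 1 ≠ x ∧ x - 1 ≠ x ∧ x + 1 ≠ x - 1 := by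
    intro k hk x
    have : NeZero k := ⟨by omega⟩
    have a := val_add_one' k hk x
    have b := val_add_one' k hk (x - 1)
    rw [sub_add_cancel] at b
    simp only [ne_eq, ← (ZMod.val_injective k).eq_iff]
    omega
  obtain ⟨v, hv, -⟩ := hS.1 (0, 0) (1, 0) (by
    intro h
    have := (hA m hm 0).1
    simp at h this
    simp [h] at this)
  obtain ⟨x, y⟩ := v
  refine lower_aux (torus m n) S hS (x, y) hv ![(x + 1, y), (x - 1, y), (x, y + 1), (x, y - 1)]
    ?_ ?_
  · have h1 := hA m hm x
    have h2 := hA n hn y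
    intro i j hij
    fin_cases i <;> fin_cases j <;> simp_all [Prod.ext_iff, eq_comm]
  · intro i
    unfold torus
    rw [boxProd_adj, cyc_adj m hm, cyc_adj n hn]
    fin_cases i <;> simp

theorem stmt_7 (m n : Nat) (hm : 3 ≤ m) (hn : 3 ≤ n) :
    mixedDim (torus m n) = 4 := by
  have hle : (resSet m n).ncard ≤ 4 := by
    unfold resSet
    refine (Set.ncard_insert_le _ _).trans ?_
    refine Nat.succ_le_succ ((Set.ncard_insert_le _ _).trans ?_)
    exact Nat.succ_le_succ ((Set.ncard_insert_le _ _).trans (by simp))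
  have hres := resSet_resolving m n hm hn
  have h4 : (resSet m n).ncard = 4 := le_antisymm hle (torus_lower m n hm hn _ hres)
  unfold mixedDim
  apply le_antisymm
  · exact Nat.sInf_le ⟨resSet m n, hres, h4⟩
  · refine le_csInf ⟨4, resSet m n, hres, h4⟩ ?_
    rintro k ⟨S, hS, rfl⟩
    exact torus_lower m n hm hn S hS
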